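/- arXiv:2602.17292 — 2 statements merged into one kernel-verified Lean document; each statement's English description precedes it below -/
import Mathlib

section
/- An H-operator-valued kernel K on X is positive semidefinite if and only if K admits a Hilbert space linearisation. Moreover, if K is positive semidefinite, then K admits a minimal Hilbert space linearisation. -/
open scoped InnerProductSpace

noncomputable section

universe u v w

/-- A bundled Hilbert space over `𝕜`. -/
structure HSp (𝕜 : Type u) [RCLike 𝕜] : Type (max u (w + 1)) where
  carrier : Type w
  [ng : NormedAddCommGroup carrier]
  [ip : InnerProductSpace 𝕜 carrier]
  [cs : CompleteSpace carrier]

attribute [instance] HSp.ng HSp.ip HSp.cs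

variable {𝕜 : Type u} [RCLike 𝕜] {X : Type v} {H : X → Type w}
  [∀ x, NormedAddCommGroup (H x)] [∀ x, InnerProductSpace 𝕜 (H x)]
  [∀ x, CompleteSpace (H x)]

/-- `K` is a Hermitian `H`-operator valued kernel: `K(x,y)* = K(y,x)`.
Here `K y x : H x →L[𝕜] H y` is the operator `K(y,x)`. -/
def IsHermitianK (K : ∀ y x : X, H x →L[𝕜] H y) : Prop :=
  ∀ x y : X, ContinuousLinearMap.adjoint (K x y) = K y x

/-- `K` is a positive semidefinite kernel: Hermitian and all the finite
quadratic sums `∑_{i,j} ⟪K(x_j,x_i) h_i, h_j⟫` are nonnegative. -/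
def IsPSDK (K : ∀ y x : X, H x →L[𝕜] H y) : Prop :=
  IsHermitianK K ∧ ∀ (n : ℕ) (x : Fin n → X) (h : ∀ i, H (x i)),
    0 ≤ RCLike.re (∑ i, ∑ j, ⟪K (x j) (x i) (h i), h j⟫_𝕜)

/-- `(𝒦, V)` is a Hilbert space linearisation of `K`: `K(x,y) = V(x)* V(y)`. -/
def IsLinearisation (K : ∀ y x : X, H x →L[𝕜] H y) (𝒦 : HSp.{u, max v w} 𝕜)
    (V : ∀ x, H x →L[𝕜] 𝒦.carrier) : Prop :=
  ∀ x y : X, K x y = (ContinuousLinearMap.adjoint (V x)).comp (V y)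

/-- Minimality: the linear span of the union of the ranges `V(x)H_x` is dense. -/
def IsMinimalLin (𝒦 : HSp.{u, max v w} 𝕜) (V : ∀ x, H x →L[𝕜] 𝒦.carrier) : Prop :=
  Dense (↑(Submodule.span 𝕜 (⋃ x : X, Set.range (V x))) : Set 𝒦.carrier)

/-- A positive semidefinite sesquilinear form on a vector space is the pullback of the inner product
of a Hilbert space along a linear map with dense range. -/
theorem PreInnerProductSpace.Core.exists_hilbert_completion {E : Type w} [AddCommGroup E]
    [Module 𝕜 E] (c : PreInnerProductSpace.Core 𝕜 E) :
    ∃ (𝒦 : HSp.{u, w} 𝕜) (J : E →ₗ[𝕜] 𝒦.carrier),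
      DenseRange J ∧ ∀ f g : E, ⟪J f, J g⟫_𝕜 = c.inner f g := by
  let : SeminormedAddCommGroup E := InnerProductSpace.Core.toSeminormedAddCommGroup (c := c)
  let : InnerProductSpace 𝕜 E := InnerProductSpace.ofCore c
  exact ⟨⟨UniformSpace.Completion E⟩,
    (UniformSpace.Completion.toComplL : E →L[𝕜] UniformSpace.Completion E).toLinearMap,
    UniformSpace.Completion.denseRange_coe, fun f g => UniformSpace.Completion.inner_coe f g⟩

/-- A linear map into an inner product space whose Gram form is represented by a bounded operator
is bounded. -/
theorem LinearMap.continuous_of_inner_apply_self {E F : Type*} [NormedAddCommGroup E]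
    [InnerProductSpace 𝕜 E] [NormedAddCommGroup F] [InnerProductSpace 𝕜 F] (L : E →ₗ[𝕜] F)
    (T : E →L[𝕜] E) (hT : ∀ h, ⟪L h, L h⟫_𝕜 = ⟪T h, h⟫_𝕜) : Continuous L := by
  refine AddMonoidHomClass.continuous_of_bound L √‖T‖ fun h => ?_
  refine (sq_le_sq₀ (norm_nonneg _) (by positivity)).mp ?_
  calc ‖L h‖ ^ 2 = RCLike.re ⟪T h, h⟫_𝕜 := by rw [← hT, inner_self_eq_norm_sq]
    _ ≤ ‖T h‖ * ‖h‖ := re_inner_le_norm _ _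
    _ ≤ ‖T‖ * ‖h‖ * ‖h‖ := by gcongr; exact T.le_opNorm h
    _ = (√‖T‖ * ‖h‖) ^ 2 := by rw [mul_pow, Real.sq_sqrt (norm_nonneg _)]; ring

open scoped Classical in
/-- The semi-inner product on finitely supported sections of the bundle induced by a positive
semidefinite kernel. -/
abbrev IsPSDK.preInnerCore {K : ∀ y x : X, H x →L[𝕜] H y} (hK : IsPSDK K) :
    PreInnerProductSpace.Core 𝕜 (Π₀ x, H x) where
  inner f g := f.sum fun x h => g.sum fun y k => ⟪K y x h, k⟫_𝕜
  conj_inner_symm f g := by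
    simp only [DFinsupp.sum, map_sum, inner_conj_symm]
    rw [Finset.sum_comm]
    refine Finset.sum_congr rfl fun x _ => Finset.sum_congr rfl fun y _ => ?_
    rw [← hK.1 x y, ContinuousLinearMap.adjoint_inner_left]
  re_inner_nonneg f := by
    let e := f.support.equivFin
    have key := hK.2 _ (fun i => (e.symm i : X)) fun i => f (e.symm i)
    have hsum : (∑ i, ∑ j, ⟪K (e.symm j : X) (e.symm i) (f (e.symm i)), f (e.symm j)⟫_𝕜) =
        ∑ x ∈ f.support, ∑ y ∈ f.support, ⟪K y x (f x), f y⟫_𝕜 := by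
      simp only [← Finset.sum_coe_sort f.support]
      rw [← e.symm.sum_comp]
      exact Finset.sum_congr rfl fun i _ =>
        e.symm.sum_comp fun y : f.support => ⟪K y (e.symm i) (f (e.symm i)), f y⟫_𝕜
    rwa [hsum] at key
  add_left f g k := by
    refine DFinsupp.sum_add_index (fun x => ?_) fun x a b => ?_
    · simp [DFinsupp.sum]
    · simp [DFinsupp.sum, inner_add_left, Finset.sum_add_distrib]
  smul_left f g r := by
    have hsub : (r • f).support ⊆ f.support := DFinsupp.support_smul r f
    simp only [DFinsupp.sum]
    rw [Finset.sum_subset hsub fun x _ hx => by simp [DFinsupp.notMem_support_iff.mp hx]]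
    simp [inner_smul_left, Finset.mul_sum]

open scoped Classical in
theorem IsPSDK.preInnerCore_single {K : ∀ y x : X, H x →L[𝕜] H y} (hK : IsPSDK K) (x y : X)
    (h : H x) (k : H y) :
    hK.preInnerCore.inner (DFinsupp.single x h) (DFinsupp.single y k) = ⟪K y x h, k⟫_𝕜 := by
  change DFinsupp.sum _ _ = _
  rw [DFinsupp.sum_single_index (by simp [DFinsupp.sum]), DFinsupp.sum_single_index (by simp)]

theorem IsPSDK.exists_minimal_linearisation {K : ∀ y x : X, H x →L[𝕜] H y} (hK : IsPSDK K) :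
    ∃ (𝒦 : HSp.{u, max v w} 𝕜) (V : ∀ x, H x →L[𝕜] 𝒦.carrier),
      IsLinearisation K 𝒦 V ∧ IsMinimalLin 𝒦 V := by
  classical
  obtain ⟨𝒦, J, hdense, hJ⟩ := hK.preInnerCore.exists_hilbert_completion
  have hinner (x y : X) (h : H x) (k : H y) :
      ⟪J (DFinsupp.single x h), J (DFinsupp.single y k)⟫_𝕜 = ⟪K y x h, k⟫_𝕜 := by
    rw [hJ, ← hK.preInnerCore_single]
  let V (x : X) : H x →L[𝕜] 𝒦.carrier :=
    ⟨J ∘ₗ DFinsupp.lsingle x, (J ∘ₗ DFinsupp.lsingle x).continuous_of_inner_apply_self (K x x)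
      fun h => hinner x x h h⟩
  refine ⟨𝒦, V, fun x y => ?_, ?_⟩
  · ext h
    refine ext_inner_right 𝕜 fun k => ?_
    rw [ContinuousLinearMap.comp_apply, ContinuousLinearMap.adjoint_inner_left]
    exact (hinner y x h k).symm
  · refine hdense.mono ?_
    rintro _ ⟨f, rfl⟩
    induction f using DFinsupp.induction with
    | h0 => simp
    | ha x h f _ _ ih =>
      rw [map_add]
      exact Submodule.add_mem _
        (Submodule.subset_span (Set.mem_iUnion.mpr ⟨x, h, rfl⟩)) ih

theorem IsLinearisation.isPSDK {K : ∀ y x : X, H x →L[𝕜] H y} {𝒦 : HSp.{u, max v w} 𝕜}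
    {V : ∀ x, H x →L[𝕜] 𝒦.carrier} (hV : IsLinearisation K 𝒦 V) : IsPSDK K := by
  refine ⟨fun x y => ?_, fun n x h => ?_⟩
  · rw [hV x y, hV y x, ContinuousLinearMap.adjoint_comp, ContinuousLinearMap.adjoint_adjoint]
  · have hsum : ∑ i, ∑ j, ⟪K (x j) (x i) (h i), h j⟫_𝕜 =
        ⟪∑ i, V (x i) (h i), ∑ j, V (x j) (h j)⟫_𝕜 := by
      rw [sum_inner]
      simp only [inner_sum]
      refine Finset.sum_congr rfl fun i _ => Finset.sum_congr rfl fun j _ => ?_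
      rw [hV, ContinuousLinearMap.comp_apply, ContinuousLinearMap.adjoint_inner_left]
    rw [hsum]
    exact inner_self_nonneg

/-- `K` is positive semidefinite iff it admits a Hilbert space
linearisation; moreover a positive semidefinite kernel admits a minimal one. -/
theorem kernel_psd_iff_exists_linearisation_and_minimal
    (K : ∀ y x : X, H x →L[𝕜] H y) :
    (IsPSDK K ↔ ∃ (𝒦 : HSp.{u, max v w} 𝕜) (V : ∀ x, H x →L[𝕜] 𝒦.carrier),
        IsLinearisation K 𝒦 V) ∧
    (IsPSDK K → ∃ (𝒦 : HSp.{u, max v w} 𝕜) (V : ∀ x, H x →L[𝕜] 𝒦.carrier),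
        IsLinearisation K 𝒦 V ∧ IsMinimalLin 𝒦 V) := by
  refine ⟨⟨fun hK => ?_, fun ⟨_, _, hV⟩ => hV.isPSDK⟩, fun hK => hK.exists_minimal_linearisation⟩
  obtain ⟨𝒦, V, hV, -⟩ := hK.exists_minimal_linearisation
  exact ⟨𝒦, V, hV⟩
end
end

section
/- Let P = {X_s}_{s∈S} be a partition of X and let K be an H-operator-valued kernel on X which is partially Hermitian with respect to P. The following are equivalent: (1) there exists a partially positive semidefinite kernel L with −L ≤_P K ≤_P L; (1′) there exists a partially positive semidefinite kernel L with K ≤_P L; (2) there exists a partially positive semidefinite kernel L such that for each s ∈ S, |[f,g]_K| ≤ ⟨f,f⟩_L^{1/2} ⟨g,g⟩_L^{1/2} for all f, g ∈ F⁰(X_s;H); (3) K = K₁ − K₂ for some partially positive semidefinite kernels K₁, K₂; (3′) K = K₁ − K₂ for some disjoint partially positive semidefinite kernels K₁, K₂; (4) there exists a minimal Krein space partial linearisation of K with respect to P. -/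
open scoped InnerProductSpace

noncomputable section

universe u uS v w w'

variable {𝕜 : Type u} [RCLike 𝕜] {X : Type v} {S : Type uS} {H : X → Type w}
  [∀ x, NormedAddCommGroup (H x)] [∀ x, InnerProductSpace 𝕜 (H x)]
  [∀ x, CompleteSpace (H x)]

/-- `K` is partially Hermitian with respect to the partition of `X` given by
the fibres of the surjection `q : X → S`. -/
def PartHermitianP (q : X → S) (K : ∀ y x : X, H x →L[𝕜] H y) : Prop :=
  ∀ x y : X, q x = q y → ContinuousLinearMap.adjoint (K x y) = K y x

/-- `K` is partially positive semidefinite with respect to the partition of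
`X` given by the fibres of `q`. -/
def PartPSDP (q : X → S) (K : ∀ y x : X, H x →L[𝕜] H y) : Prop :=
  PartHermitianP q K ∧
  ∀ (s : S) (n : ℕ) (x : Fin n → X), (∀ i, q (x i) = s) →
    ∀ h : ∀ i, H (x i),
      0 ≤ RCLike.re (∑ i, ∑ j, ⟪K (x j) (x i) (h i), h j⟫_𝕜)

/-- The partial order: `K ≤_P L` iff `L - K` is partially positive
semidefinite. -/
def PKLE (q : X → S) (K L : ∀ y x : X, H x →L[𝕜] H y) : Prop :=
  PartPSDP q (fun y x => L y x - K y x)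

/-- Disjointness of two partially positive semidefinite kernels. -/
def PDisjoint (q : X → S) (K₁ K₂ : ∀ y x : X, H x →L[𝕜] H y) : Prop :=
  ∀ P : ∀ y x : X, H x →L[𝕜] H y,
    PartPSDP q P → PKLE q P K₁ → PKLE q P K₂ →
    ∀ y x : X, q x = q y → P y x = 0

/-- A bundled Krein space over `𝕜`: a Hilbert space together with a
fundamental symmetry `J`; the indefinite inner product is `[h,k] = ⟪Jh,k⟫`. -/
structure KSp (𝕜 : Type u) [RCLike 𝕜] : Type (max u (w' + 1)) where
  carrier : Type w'
  [ng : NormedAddCommGroup carrier]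
  [ip : InnerProductSpace 𝕜 carrier]
  [cs : CompleteSpace carrier]
  J : carrier →L[𝕜] carrier
  J_adj : ContinuousLinearMap.adjoint J = J
  J_sq : J.comp J = ContinuousLinearMap.id 𝕜 carrier

attribute [instance] KSp.ng KSp.ip KSp.cs

/-- Transport between the members of a bundle of Krein spaces along an
equality of indices. -/
def castK (𝕜 : Type u) [RCLike 𝕜] {S : Type uS} (𝒦 : S → KSp.{u, w'} 𝕜)
    {s t : S} (h : s = t) : (𝒦 s).carrier ≃ₗᵢ[𝕜] (𝒦 t).carrier := by
  subst h; exact LinearIsometryEquiv.refl 𝕜 (𝒦 s).carrier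

/-- A Krein space partial linearisation of `K` with respect to the partition
given by `q`: a bundle of Krein spaces `{𝒦_s}` and bounded operators
`V_x : H_x → 𝒦_{q(x)}` with `K(x,y) = V_x* J_s V_y` on each fibre. -/
def IsPartKreinLin (q : X → S) (K : ∀ y x : X, H x →L[𝕜] H y)
    (𝒦 : S → KSp.{u, w'} 𝕜) (V : ∀ x : X, H x →L[𝕜] (𝒦 (q x)).carrier) :
    Prop :=
  ∀ (x y : X) (hxy : q y = q x) (k : H y) (h : H x),
    ⟪(K x y) k, h⟫_𝕜 = ⟪(𝒦 (q x)).J (castK 𝕜 𝒦 hxy (V y k)), V x h⟫_𝕜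

/-- Minimality of a Krein space partial linearisation. -/
def IsMinimalPartKLin (q : X → S) (𝒦 : S → KSp.{u, w'} 𝕜)
    (V : ∀ x : X, H x →L[𝕜] (𝒦 (q x)).carrier) : Prop :=
  ∀ s : S, Dense (↑(Submodule.span 𝕜 (⋃ x : {x : X // q x = s},
    Set.range fun h : H x.val => castK 𝕜 𝒦 x.2 (V x.val h))) :
      Set (𝒦 s).carrier)

section Block

open Filter Topology ContinuousLinearMap

variable {Y : Type v} {G : Y → Type w}
  [∀ x, NormedAddCommGroup (G x)] [∀ x, InnerProductSpace 𝕜 (G x)]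
  [∀ x, CompleteSpace (G x)]

/-- A positive semidefinite operator-valued kernel on the whole of `Y`. -/
def IsPSDKernel (K : ∀ y x : Y, G x →L[𝕜] G y) : Prop :=
  (∀ x y : Y, adjoint (K x y) = K y x) ∧
  ∀ (n : ℕ) (x : Fin n → Y) (h : ∀ i, G (x i)),
    0 ≤ RCLike.re (∑ i, ∑ j, ⟪K (x j) (x i) (h i), h j⟫_𝕜)

theorem adjoint_eq_iff_inner {E F : Type*} [NormedAddCommGroup E] [InnerProductSpace 𝕜 E]
    [CompleteSpace E] [NormedAddCommGroup F] [InnerProductSpace 𝕜 F] [CompleteSpace F]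
    (A : E →L[𝕜] F) (B : F →L[𝕜] E) :
    adjoint A = B ↔ ∀ h k, ⟪A h, k⟫_𝕜 = ⟪h, B k⟫_𝕜 := by
  rw [eq_comm, eq_adjoint_iff]
  refine ⟨fun H h k => ?_, fun H k h => ?_⟩
  · rw [← inner_conj_symm, ← H, inner_conj_symm]
  · rw [← inner_conj_symm, ← H, inner_conj_symm]

namespace IsPSDKernel

variable {K L M : ∀ y x : Y, G x →L[𝕜] G y}

theorem inner_symm (hK : IsPSDKernel K) (x y : Y) (h : G y) (k : G x) :
    ⟪K x y h, k⟫_𝕜 = ⟪h, K y x k⟫_𝕜 :=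
  (adjoint_eq_iff_inner _ _).1 (hK.1 x y) h k

protected theorem zero : IsPSDKernel (fun y x : Y => (0 : G x →L[𝕜] G y)) :=
  ⟨fun x y => by simp, fun n x h => by simp⟩

protected theorem add (hK : IsPSDKernel K) (hL : IsPSDKernel L) :
    IsPSDKernel (fun y x => K y x + L y x) := by
  refine ⟨fun x y => by rw [map_add, hK.1, hL.1], fun n x h => ?_⟩
  have := add_nonneg (hK.2 n x h) (hL.2 n x h)
  simpa only [add_apply, inner_add_left, Finset.sum_add_distrib, map_add] using this

theorem sub_trans (hKL : IsPSDKernel (fun y x => L y x - K y x))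
    (hLM : IsPSDKernel (fun y x => M y x - L y x)) :
    IsPSDKernel (fun y x => M y x - K y x) := by
  simpa using hLM.add hKL

theorem re_diag_nonneg (hK : IsPSDKernel K) (x : Y) (h : G x) :
    0 ≤ RCLike.re ⟪K x x h, h⟫_𝕜 := by
  simpa using hK.2 1 (fun _ => x) (fun _ => h)

/-- Kernels factoring through a positive operator are positive semidefinite. -/
theorem of_isPositive {E : Type*} [NormedAddCommGroup E] [InnerProductSpace 𝕜 E]
    [CompleteSpace E] (V : ∀ x : Y, G x →L[𝕜] E) {A : E →L[𝕜] E} (hA : A.IsPositive)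
    (hK : ∀ x y h k, ⟪K y x h, k⟫_𝕜 = ⟪A (V x h), V y k⟫_𝕜) : IsPSDKernel K := by
  refine ⟨fun x y => (adjoint_eq_iff_inner _ _).2 fun h k => ?_, fun n x h => ?_⟩
  · rw [hK, ← inner_conj_symm h, hK, inner_conj_symm]
    exact hA.inner_left_eq_inner_right _ _
  · have := hA.re_inner_nonneg_left (∑ i, V (x i) (h i))
    rw [map_sum, sum_inner] at this
    simpa only [hK, inner_sum] using this

open Classical in
/-- The semi-inner product on finitely supported sections induced by a positive semidefinite
kernel. -/
@[reducible] def core (hK : IsPSDKernel K) : PreInnerProductSpace.Core 𝕜 (Π₀ y, G y) where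
  inner f g := f.sum fun x a => g.sum fun y b => ⟪K y x a, b⟫_𝕜
  conj_inner_symm f g := by
    simp only [DFinsupp.sum, map_sum, inner_conj_symm]
    rw [Finset.sum_comm]
    exact Finset.sum_congr rfl fun x _ => Finset.sum_congr rfl fun y _ =>
      (hK.inner_symm y x _ _).symm
  re_inner_nonneg f := by
    have := hK.2 _ (fun i => (f.support.equivFin.symm i : Y)) (fun i => f _)
    simp only [DFinsupp.sum]
    convert this using 2
    rw [← Finset.sum_coe_sort, ← Equiv.sum_comp f.support.equivFin.symm]
    refine Finset.sum_congr rfl fun i _ => ?_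
    rw [← Finset.sum_coe_sort, ← Equiv.sum_comp f.support.equivFin.symm]
  add_left f g h := by
    rw [DFinsupp.sum_add_index]
    · intro i; simp [DFinsupp.sum]
    · intro i a b; simp [DFinsupp.sum, inner_add_left, Finset.sum_add_distrib]
  smul_left f g r := by
    have hsub : (r • f).support ⊆ f.support := DFinsupp.support_smul r f
    rw [DFinsupp.sum, Finset.sum_subset hsub]
    · simp [DFinsupp.sum, inner_smul_left, Finset.mul_sum]
    · intro i _ hi
      rw [DFinsupp.notMem_support_iff.1 hi]
      simp [DFinsupp.sum]

/-- Kolmogorov decomposition of a positive semidefinite kernel. -/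
theorem exists_factorization (hK : IsPSDKernel K) :
    ∃ (E : Type (max v w)) (_ : NormedAddCommGroup E) (_ : InnerProductSpace 𝕜 E)
      (_ : CompleteSpace E) (V : ∀ x : Y, G x →L[𝕜] E),
      ∀ x y h k, ⟪K y x h, k⟫_𝕜 = ⟪V x h, V y k⟫_𝕜 := by
  classical
  let _ : SeminormedAddCommGroup (Π₀ y, G y) :=
    @InnerProductSpace.Core.toSeminormedAddCommGroup 𝕜 _ _ _ _ hK.core
  let _ : InnerProductSpace 𝕜 (Π₀ y, G y) := InnerProductSpace.ofCore hK.core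
  have key : ∀ x y (h : G x) (k : G y),
      ⟪DFinsupp.single x h, DFinsupp.single y k⟫_𝕜 = ⟪K y x h, k⟫_𝕜 := by
    intro x y h k
    change DFinsupp.sum _ _ = _
    rw [DFinsupp.sum_single_index, DFinsupp.sum_single_index]
    · simp
    · simp [DFinsupp.sum]
  have bound : ∀ x (h : G x), ‖DFinsupp.lsingle (R := 𝕜) (M := G) x h‖ ≤ √‖K x x‖ * ‖h‖ := by
    intro x h
    refine abs_le_of_sq_le_sq' ?_ (by positivity) |>.2
    rw [mul_pow, Real.sq_sqrt (norm_nonneg _), ← inner_self_eq_norm_sq (𝕜 := 𝕜)]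
    rw [DFinsupp.lsingle_apply, key]
    calc _ ≤ ‖K x x h‖ * ‖h‖ := re_inner_le_norm _ _
      _ ≤ ‖K x x‖ * ‖h‖ * ‖h‖ := by gcongr; exact le_opNorm _ _
      _ = _ := by ring
  refine ⟨UniformSpace.Completion (Π₀ y, G y), inferInstance, inferInstance, inferInstance,
    fun x => UniformSpace.Completion.toComplL.comp
      ((DFinsupp.lsingle (R := 𝕜) (M := G) x).mkContinuous _ (bound x)), fun x y h k => ?_⟩
  simp only [coe_comp, Function.comp_apply, UniformSpace.Completion.coe_toComplL,
    LinearMap.mkContinuous_apply, UniformSpace.Completion.inner_coe]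
  exact (key x y h k).symm

theorem norm_le (hK : IsPSDKernel K) (hKL : IsPSDKernel (fun y x => L y x - K y x)) (y x : Y) :
    ‖K y x‖ ≤ √‖L x x‖ * √‖L y y‖ := by
  obtain ⟨E, _, _, _, V, hV⟩ := hK.exists_factorization
  have bound : ∀ x h, ‖V x h‖ ≤ √‖L x x‖ * ‖h‖ := by
    intro x h
    refine abs_le_of_sq_le_sq' ?_ (by positivity) |>.2
    rw [mul_pow, Real.sq_sqrt (norm_nonneg _), ← inner_self_eq_norm_sq (𝕜 := 𝕜), ← hV]
    have := hKL.re_diag_nonneg x h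
    rw [sub_apply, inner_sub_left, map_sub] at this
    calc _ ≤ RCLike.re ⟪L x x h, h⟫_𝕜 := by linarith
      _ ≤ ‖L x x h‖ * ‖h‖ := re_inner_le_norm _ _
      _ ≤ ‖L x x‖ * ‖h‖ * ‖h‖ := by gcongr; exact le_opNorm _ _
      _ = _ := by ring
  refine opNorm_le_of_re_inner_le (𝕜 := 𝕜) (by positivity) fun h k hh hk => ?_
  rw [hV]
  calc _ ≤ ‖V x h‖ * ‖V y k‖ := re_inner_le_norm _ _
    _ ≤ (√‖L x x‖ * ‖h‖) * (√‖L y y‖ * ‖k‖) := by gcongr <;> exact bound _ _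
    _ = _ := by rw [hh, hk, mul_one, mul_one]

theorem norm_sum_le (hK : IsPSDKernel K) {n m : ℕ} (x : Fin n → Y) (y : Fin m → Y)
    (f : ∀ i, G (x i)) (g : ∀ j, G (y j)) :
    ‖∑ i, ∑ j, ⟪K (y j) (x i) (f i), g j⟫_𝕜‖ ≤
      √(RCLike.re (∑ i, ∑ i', ⟪K (x i') (x i) (f i), f i'⟫_𝕜)) *
      √(RCLike.re (∑ j, ∑ j', ⟪K (y j') (y j) (g j), g j'⟫_𝕜)) := by
  obtain ⟨E, _, _, _, V, hV⟩ := hK.exists_factorization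
  simp only [hV, ← inner_sum, ← sum_inner]
  rw [inner_self_eq_norm_sq, inner_self_eq_norm_sq, Real.sqrt_sq (norm_nonneg _),
    Real.sqrt_sq (norm_nonneg _)]
  exact norm_inner_le_norm _ _

end IsPSDKernel

/-- Weak operator compactness of bounded families of operators, along an ultrafilter. -/
theorem exists_weak_limit {α E F : Type*} [NormedAddCommGroup E] [InnerProductSpace 𝕜 E]
    [NormedAddCommGroup F] [InnerProductSpace 𝕜 F] [CompleteSpace F]
    (U : Ultrafilter α) (T : α → E →L[𝕜] F) (C : ℝ) (hT : ∀ᶠ a in U, ‖T a‖ ≤ C) :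
    ∃ T₀ : E →L[𝕜] F, ∀ h k, Tendsto (fun a => ⟪T a h, k⟫_𝕜) U (𝓝 ⟪T₀ h, k⟫_𝕜) := by
  have hb : ∀ h k, ∃ b : 𝕜, ‖b‖ ≤ C * ‖h‖ * ‖k‖ ∧ Tendsto (fun a => ⟪T a h, k⟫_𝕜) U (𝓝 b) := by
    intro h k
    have hmem : ∀ᶠ a in U, ⟪T a h, k⟫_𝕜 ∈ Metric.closedBall (0 : 𝕜) (C * ‖h‖ * ‖k‖) := by
      filter_upwards [hT] with a ha
      rw [mem_closedBall_zero_iff]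
      refine (norm_inner_le_norm _ _).trans ?_
      gcongr
      exact le_of_opNorm_le _ ha h
    obtain ⟨b, hb, hlim⟩ := (isCompact_closedBall (0 : 𝕜) (C * ‖h‖ * ‖k‖)).ultrafilter_le_nhds
      (U.map fun a => ⟪T a h, k⟫_𝕜) (le_principal_iff.2 hmem)
    exact ⟨b, mem_closedBall_zero_iff.1 hb, hlim⟩
  choose b hbC hb using hb
  let B : E →ₗ⋆[𝕜] F →ₗ[𝕜] 𝕜 := LinearMap.mk₂'ₛₗ (starRingEnd 𝕜) (RingHom.id 𝕜) b
    (fun h₁ h₂ k => tendsto_nhds_unique (hb _ _) <| by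
      simpa only [map_add, inner_add_left] using (hb h₁ k).add (hb h₂ k))
    (fun c h k => tendsto_nhds_unique (hb _ _) <| by
      simpa only [map_smul, inner_smul_left, smul_eq_mul] using (hb h k).const_mul (starRingEnd 𝕜 c))
    (fun h k₁ k₂ => tendsto_nhds_unique (hb _ _) <| by
      simpa only [inner_add_right] using (hb h k₁).add (hb h k₂))
    (fun c h k => tendsto_nhds_unique (hb _ _) <| by
      simpa only [inner_smul_right, smul_eq_mul, RingHom.id_apply] using (hb h k).const_mul c)
  let B' : E →L⋆[𝕜] F →L[𝕜] 𝕜 := B.mkContinuous₂ C hbC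
  refine ⟨((InnerProductSpace.toDual 𝕜 F).symm.toContinuousLinearEquiv :
    StrongDual 𝕜 F →L⋆[𝕜] F).comp B', fun h k => ?_⟩
  have : ⟪(InnerProductSpace.toDual 𝕜 F).symm (B' h), k⟫_𝕜 = b h k := by
    rw [InnerProductSpace.toDual_symm_apply]
    rfl
  simpa [this] using hb h k

namespace IsPSDKernel

variable {K L : ∀ y x : Y, G x →L[𝕜] G y}

theorem of_tendsto {α : Type*} {l : Filter α} [l.NeBot] {T : α → ∀ y x : Y, G x →L[𝕜] G y}
    (hT : ∀ᶠ a in l, IsPSDKernel (T a))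
    (hK : ∀ y x h k, Tendsto (fun a => ⟪T a y x h, k⟫_𝕜) l (𝓝 ⟪K y x h, k⟫_𝕜)) :
    IsPSDKernel K := by
  refine ⟨fun x y => (adjoint_eq_iff_inner _ _).2 fun h k => ?_, fun n x h => ?_⟩
  · refine tendsto_nhds_unique_of_eventuallyEq (hK x y h k) ?_
      (hT.mono fun a ha => ha.inner_symm x y h k)
    simpa only [inner_conj_symm, Function.comp_def] using
      (RCLike.continuous_conj.tendsto _).comp (hK y x k h)
  · refine ge_of_tendsto ((RCLike.continuous_re.tendsto _).comp <|
      tendsto_finsetSum _ fun i _ => tendsto_finsetSum _ fun j _ => hK (x j) (x i) (h i) (h j)) ?_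
    exact hT.mono fun a ha => ha.2 n x h

theorem eq_zero_of_neg (hK : IsPSDKernel K) (hK' : IsPSDKernel (fun y x => -K y x)) (y x : Y) :
    K y x = 0 := by
  have h := hK.norm_le (L := fun y x => 0) (by simpa using hK') y x
  simpa using h

end IsPSDKernel

/-- Two kernels are disjoint if zero is their only common positive semidefinite minorant. -/
def DisjointKernels (K₁ K₂ : ∀ y x : Y, G x →L[𝕜] G y) : Prop :=
  ∀ P : ∀ y x : Y, G x →L[𝕜] G y, IsPSDKernel P →
    IsPSDKernel (fun y x => K₁ y x - P y x) → IsPSDKernel (fun y x => K₂ y x - P y x) →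
    ∀ y x, P y x = 0

/-- A chain of common minorants of two kernels has an upper bound among the common minorants. -/
theorem exists_upperBound_of_chain {K₁ K₂ : ∀ y x : Y, G x →L[𝕜] G y}
    {c : Set (∀ y x : Y, G x →L[𝕜] G y)} (hne : c.Nonempty)
    (hc : ∀ P ∈ c, ∀ Q ∈ c, IsPSDKernel (fun y x => Q y x - P y x) ∨
      IsPSDKernel (fun y x => P y x - Q y x))
    (hmem : ∀ P ∈ c, IsPSDKernel P ∧ IsPSDKernel (fun y x => K₁ y x - P y x) ∧
      IsPSDKernel (fun y x => K₂ y x - P y x)) :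
    ∃ Q, (IsPSDKernel Q ∧ IsPSDKernel (fun y x => K₁ y x - Q y x) ∧
      IsPSDKernel (fun y x => K₂ y x - Q y x)) ∧
      ∀ P ∈ c, IsPSDKernel (fun y x => Q y x - P y x) := by
  let f : c → Filter (∀ y x : Y, G x →L[𝕜] G y) := fun P =>
    𝓟 {T | T ∈ c ∧ IsPSDKernel (fun y x => T y x - P.1 y x)}
  have hmono : ∀ P Q : c, IsPSDKernel (fun y x => Q.1 y x - P.1 y x) → f Q ≤ f P :=
    fun P Q hPQ => principal_mono.2 fun T hT => ⟨hT.1, hPQ.sub_trans hT.2⟩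
  have : Nonempty c := hne.to_subtype
  have hbot : (iInf f).NeBot := by
    refine iInf_neBot_of_directed' (fun P Q => ?_) fun P => ?_
    · rcases hc P P.2 Q Q.2 with h | h
      · exact ⟨Q, hmono _ _ h, le_rfl⟩
      · exact ⟨P, le_rfl, hmono _ _ h⟩
    · refine principal_neBot_iff.2 ⟨P, P.2, ?_⟩
      simpa using IsPSDKernel.zero (𝕜 := 𝕜) (G := G)
  let U : Ultrafilter (∀ y x : Y, G x →L[𝕜] G y) := Ultrafilter.of (iInf f)
  have hU : ∀ P ∈ c, ∀ᶠ T in U, T ∈ c ∧ IsPSDKernel (fun y x => T y x - P y x) := fun P hP =>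
    (Ultrafilter.of_le (iInf f)).trans (iInf_le f ⟨P, hP⟩) (mem_principal_self _)
  have hUc : ∀ᶠ T in U, T ∈ c := (hU _ hne.some_mem).mono fun T hT => hT.1
  have hlim := fun y x => exists_weak_limit U (fun T => T y x) _
    (hUc.mono fun T hT => (hmem T hT).1.norm_le (hmem T hT).2.1 y x)
  choose Q hQ using hlim
  refine ⟨Q, ⟨.of_tendsto (hUc.mono fun T hT => (hmem T hT).1) hQ,
    .of_tendsto (hUc.mono fun T hT => (hmem T hT).2.1) fun y x h k => ?_,
    .of_tendsto (hUc.mono fun T hT => (hmem T hT).2.2) fun y x h k => ?_⟩,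
    fun P hP => .of_tendsto ((hU P hP).mono fun T hT => hT.2) fun y x h k => ?_⟩
  · simpa only [sub_apply, inner_sub_left] using (hQ y x h k).const_sub _
  · simpa only [sub_apply, inner_sub_left] using (hQ y x h k).const_sub _
  · simpa only [sub_apply, inner_sub_left] using (hQ y x h k).sub_const _

/-- A difference of positive semidefinite kernels is a difference of disjoint ones. -/
theorem IsPSDKernel.exists_disjoint {K₁ K₂ : ∀ y x : Y, G x →L[𝕜] G y}
    (h₁ : IsPSDKernel K₁) (h₂ : IsPSDKernel K₂) :
    ∃ L₁ L₂ : ∀ y x : Y, G x →L[𝕜] G y, IsPSDKernel L₁ ∧ IsPSDKernel L₂ ∧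
      DisjointKernels L₁ L₂ ∧ ∀ y x, L₁ y x - L₂ y x = K₁ y x - K₂ y x := by
  let p : (∀ y x : Y, G x →L[𝕜] G y) → Prop := fun P => IsPSDKernel P ∧
    IsPSDKernel (fun y x => K₁ y x - P y x) ∧ IsPSDKernel (fun y x => K₂ y x - P y x)
  let r : {P // p P} → {P // p P} → Prop := fun P Q => IsPSDKernel (fun y x => Q.1 y x - P.1 y x)
  have hbdd : ∀ c, IsChain r c → ∃ ub, ∀ a ∈ c, r a ub := by
    intro c hc
    rcases c.eq_empty_or_nonempty with rfl | hne
    · exact ⟨⟨fun _ _ => 0, .zero, by simpa using h₁, by simpa using h₂⟩, by simp⟩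
    · obtain ⟨Q, hQ, hub⟩ := exists_upperBound_of_chain (K₁ := K₁) (K₂ := K₂)
        (c := Subtype.val '' c) (hne.image _) (by
          rintro _ ⟨P, hP, rfl⟩ _ ⟨Q, hQ, rfl⟩
          rcases eq_or_ne P Q with rfl | hPQ
          · exact Or.inl (by simpa using IsPSDKernel.zero (𝕜 := 𝕜) (G := G))
          · exact hc hP hQ hPQ) (by rintro _ ⟨P, -, rfl⟩; exact P.2)
      exact ⟨⟨Q, hQ⟩, fun P hP => hub P ⟨P, hP, rfl⟩⟩
  obtain ⟨⟨P, hP, hP₁, hP₂⟩, hmax⟩ :=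
    exists_maximal_of_chains_bounded hbdd (fun hab hbc => hab.sub_trans hbc)
  refine ⟨_, _, hP₁, hP₂, fun Q hQ hQ₁ hQ₂ => hQ.eq_zero_of_neg ?_, fun y x => by abel⟩
  have := hmax ⟨fun y x => P y x + Q y x, hP.add hQ, by simpa only [sub_sub] using hQ₁,
    by simpa only [sub_sub] using hQ₂⟩ (by simpa [r] using hQ)
  simpa [r] using this

/-- Complementary positive operators whose compressions to a dense range are disjoint kernels
are idempotent. -/
theorem DisjointKernels.mul_self_eq {E : Type*} [NormedAddCommGroup E] [InnerProductSpace 𝕜 E]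
    [CompleteSpace E] {V : ∀ x : Y, G x →L[𝕜] E} {A C : E →L[𝕜] E} (hA : A.IsPositive)
    (hC : C.IsPositive) (hAC : A + C = 1) {K₁ K₂ : ∀ y x : Y, G x →L[𝕜] G y}
    (hd : DisjointKernels K₁ K₂)
    (h₁ : ∀ x y h k, ⟪K₁ y x h, k⟫_𝕜 = ⟪A (V x h), V y k⟫_𝕜)
    (h₂ : ∀ x y h k, ⟪K₂ y x h, k⟫_𝕜 = ⟪C (V x h), V y k⟫_𝕜)
    (hV : Dense (Submodule.span 𝕜 (⋃ x, Set.range (V x)) : Set E)) : A * A = A := by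
  have hC_eq : C = 1 - A := eq_sub_of_add_eq' hAC
  have hB : (A * C).IsPositive := by
    have e : A * C = A * (C * A) + C * (A * C) := by rw [hC_eq]; noncomm_ring
    rw [e]
    refine .add ?_ ?_
    · have := hC.adjoint_conj A
      rwa [hA.isSelfAdjoint.adjoint_eq] at this
    · have := hA.adjoint_conj C
      rwa [hC.isSelfAdjoint.adjoint_eq] at this
  have hAA : (A * A).IsPositive := by
    have := isPositive_adjoint_comp_self A
    rwa [hA.isSelfAdjoint.adjoint_eq] at this
  have hCC : (C * C).IsPositive := by
    have := isPositive_adjoint_comp_self C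
    rwa [hC.isSelfAdjoint.adjoint_eq] at this
  have hzero := hd (fun y x => adjoint (V y) ∘L (A * C) ∘L V x)
    (.of_isPositive V hB fun x y h k => by rw [comp_apply, comp_apply, adjoint_inner_left])
    (.of_isPositive V hAA fun x y h k => by
      have e : A * A = A - A * C := by rw [hC_eq]; noncomm_ring
      rw [e, sub_apply, sub_apply, inner_sub_left, inner_sub_left, h₁, comp_apply, comp_apply,
        adjoint_inner_left])
    (.of_isPositive V hCC fun x y h k => by
      have e : C * C = C - A * C := by rw [hC_eq]; noncomm_ring
      rw [e, sub_apply, sub_apply, inner_sub_left, inner_sub_left, h₂, comp_apply, comp_apply,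
        adjoint_inner_left])
  have hB0 : A * C = 0 := by
    refine ext_on hV ?_
    rintro _ hz
    obtain ⟨x, h, rfl⟩ := Set.mem_iUnion.1 hz
    refine hV.eq_of_inner_left 𝕜 fun z hz' => ?_
    rw [zero_apply, inner_zero_left]
    induction hz' using Submodule.span_induction with
    | mem z hz' =>
      obtain ⟨y, k, rfl⟩ := Set.mem_iUnion.1 hz'
      rw [← adjoint_inner_left]
      have := congrArg (fun T => ⟪T h, k⟫_𝕜) (hzero y x)
      simpa using this
    | zero => exact inner_zero_right _
    | add a b _ _ ha hb => rw [inner_add_right, ha, hb, add_zero]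
    | smul c a _ ha => rw [inner_smul_right, ha, mul_zero]
  rw [hC_eq, mul_sub, mul_one, sub_eq_zero] at hB0
  exact hB0.symm

/-- The difference of two complementary positive operators, the first being idempotent, is a
fundamental symmetry. -/
@[reducible] def KSp.ofIdempotent {E : Type w'} [NormedAddCommGroup E] [InnerProductSpace 𝕜 E]
    [CompleteSpace E] (A C : E →L[𝕜] E) (hA : A.IsPositive) (hC : C.IsPositive)
    (hAC : A + C = 1) (hAA : A * A = A) : KSp.{u, w'} 𝕜 where
  carrier := E
  J := A - C
  J_adj := (hA.isSelfAdjoint.sub hC.isSelfAdjoint).adjoint_eq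
  J_sq := by
    obtain rfl : C = 1 - A := eq_sub_of_add_eq' hAC
    change (A - (1 - A)) * (A - (1 - A)) = 1
    simp only [mul_sub, sub_mul, mul_one, one_mul, hAA]
    abel

/-- A difference of disjoint positive semidefinite kernels has a minimal Krein space
linearisation. -/
theorem DisjointKernels.exists_krein {K₁ K₂ : ∀ y x : Y, G x →L[𝕜] G y}
    (hd : DisjointKernels K₁ K₂) (h₁ : IsPSDKernel K₁) (h₂ : IsPSDKernel K₂) :
    ∃ (𝒦 : KSp.{u, max v w} 𝕜) (V : ∀ x : Y, G x →L[𝕜] 𝒦.carrier),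
      (∀ x y h k, ⟪K₁ y x h - K₂ y x h, k⟫_𝕜 = ⟪𝒦.J (V x h), V y k⟫_𝕜) ∧
      Dense (Submodule.span 𝕜 (⋃ x, Set.range (V x)) : Set 𝒦.carrier) := by
  obtain ⟨E₁, _, _, _, V₁, hV₁⟩ := h₁.exists_factorization
  obtain ⟨E₂, _, _, _, V₂, hV₂⟩ := h₂.exists_factorization
  let V₀ : ∀ x : Y, G x →L[𝕜] WithLp 2 (E₁ × E₂) := fun x =>
    ((WithLp.prodContinuousLinearEquiv 2 𝕜 E₁ E₂).symm : E₁ × E₂ →L[𝕜] _).comp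
      ((V₁ x).prod (V₂ x))
  let Z := (Submodule.span 𝕜 (⋃ x, Set.range (V₀ x))).topologicalClosure
  have hV₀ : ∀ x h, V₀ x h ∈ Z := fun x h =>
    Submodule.le_topologicalClosure _ (Submodule.subset_span (Set.mem_iUnion.2 ⟨x, h, rfl⟩))
  have : CompleteSpace Z := (Submodule.isClosed_topologicalClosure _).completeSpace_coe
  let V : ∀ x : Y, G x →L[𝕜] Z := fun x => (V₀ x).codRestrict Z (hV₀ x)
  have hdense : Dense (Submodule.span 𝕜 (⋃ x, Set.range (V x)) : Set Z) := by
    rw [Subtype.dense_iff]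
    have e : Subtype.val '' (Submodule.span 𝕜 (⋃ x, Set.range (V x)) : Set Z) =
        (Submodule.span 𝕜 (⋃ x, Set.range (V₀ x)) : Set (WithLp 2 (E₁ × E₂))) := by
      have := Submodule.map_span Z.subtype (⋃ x, Set.range (V x))
      rw [Set.image_iUnion] at this
      simp only [← Set.range_comp] at this
      exact congrArg SetLike.coe this
    exact fun z hz => (congrArg closure e).symm ▸ hz
  let W₁ : Z →L[𝕜] E₁ := (WithLp.fstL 2 𝕜 E₁ E₂).comp Z.subtypeL
  let W₂ : Z →L[𝕜] E₂ := (WithLp.sndL 2 𝕜 E₁ E₂).comp Z.subtypeL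
  let A : Z →L[𝕜] Z := adjoint W₁ ∘L W₁
  have hA : A.IsPositive := isPositive_adjoint_comp_self W₁
  let C : Z →L[𝕜] Z := adjoint W₂ ∘L W₂
  have hC : C.IsPositive := isPositive_adjoint_comp_self W₂
  have hAC : A + C = 1 := by
    ext1 z
    refine ext_inner_right 𝕜 fun z' => ?_
    rw [add_apply, inner_add_left, show A z = adjoint W₁ (W₁ z) from rfl,
      show C z = adjoint W₂ (W₂ z) from rfl, adjoint_inner_left, adjoint_inner_left]
    exact (WithLp.prod_inner_apply (𝕜 := 𝕜) z.1 z'.1).symm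
  have hK₁ : ∀ x y h k, ⟪K₁ y x h, k⟫_𝕜 = ⟪A (V x h), V y k⟫_𝕜 := fun x y h k => by
    rw [hV₁, comp_apply, adjoint_inner_left]
    rfl
  have hK₂ : ∀ x y h k, ⟪K₂ y x h, k⟫_𝕜 = ⟪C (V x h), V y k⟫_𝕜 := fun x y h k => by
    rw [hV₂, comp_apply, adjoint_inner_left]
    rfl
  refine ⟨.ofIdempotent A C hA hC hAC (hd.mul_self_eq hA hC hAC hK₁ hK₂ hdense), V,
    fun x y h k => ?_, hdense⟩
  rw [inner_sub_left, hK₁, hK₂, ← inner_sub_left]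
  rfl

end Block

section Partition

open ContinuousLinearMap

theorem partPSDP_iff {q : X → S} {K : ∀ y x : X, H x →L[𝕜] H y} :
    PartPSDP q K ↔ ∀ s, IsPSDKernel (fun y x : {x // q x = s} => K y x) :=
  ⟨fun h s => ⟨fun x y => h.1 x y (x.2.trans y.2.symm),
      fun n x f => h.2 s n (fun i => x i) (fun i => (x i).2) f⟩,
    fun h => ⟨fun x y hxy => (h (q y)).1 ⟨x, hxy⟩ ⟨y, rfl⟩,
      fun s n x hx f => (h s).2 n (fun i => ⟨x i, hx i⟩) f⟩⟩

open Classical in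
/-- The kernel which agrees with `P s` on the block over `s`, and with `K₀` off the blocks. -/
def glueKernels (q : X → S) (K₀ : ∀ y x : X, H x →L[𝕜] H y)
    (P : ∀ s, ∀ y x : {x // q x = s}, H x.1 →L[𝕜] H y.1) (y x : X) : H x →L[𝕜] H y :=
  if h : q x = q y then P (q y) ⟨y, rfl⟩ ⟨x, h⟩ else K₀ y x

theorem glueKernels_apply (q : X → S) (K₀ : ∀ y x : X, H x →L[𝕜] H y)
    (P : ∀ s, ∀ y x : {x // q x = s}, H x.1 →L[𝕜] H y.1) {s : S} (y x : {x // q x = s}) :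
    glueKernels q K₀ P y x = P s y x := by
  obtain ⟨y, rfl⟩ := y
  exact dif_pos x.2

theorem glueKernels_of_ne (q : X → S) (K₀ : ∀ y x : X, H x →L[𝕜] H y)
    (P : ∀ s, ∀ y x : {x // q x = s}, H x.1 →L[𝕜] H y.1) {y x : X} (h : q x ≠ q y) :
    glueKernels q K₀ P y x = K₀ y x :=
  dif_neg h

theorem PartPSDP.add {q : X → S} {K L : ∀ y x : X, H x →L[𝕜] H y} (hK : PartPSDP q K)
    (hL : PartPSDP q L) : PartPSDP q (fun y x => K y x + L y x) :=
  partPSDP_iff.2 fun s => (partPSDP_iff.1 hK s).add (partPSDP_iff.1 hL s)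

theorem exists_two_sided_bound_of_sub {q : X → S} {K K₁ K₂ : ∀ y x : X, H x →L[𝕜] H y}
    (h₁ : PartPSDP q K₁) (h₂ : PartPSDP q K₂) (hK : ∀ y x, K y x = K₁ y x - K₂ y x) :
    ∃ L : ∀ y x : X, H x →L[𝕜] H y, PartPSDP q L ∧
      PKLE q (fun y x => -(L y x)) K ∧ PKLE q K L := by
  refine ⟨fun y x => K₁ y x + K₂ y x, h₁.add h₂, ?_, ?_⟩
  · have e : (fun y x => K y x - -(K₁ y x + K₂ y x)) = fun y x => K₁ y x + K₁ y x := by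
      funext y x; rw [hK]; abel
    rw [PKLE, e]
    exact h₁.add h₁
  · have e : (fun y x => (K₁ y x + K₂ y x) - K y x) = fun y x => K₂ y x + K₂ y x := by
      funext y x; rw [hK]; abel
    rw [PKLE, e]
    exact h₂.add h₂

theorem sqrt_mul_add_sqrt_mul_le {a b c d : ℝ} (ha : 0 ≤ a) (hb : 0 ≤ b) (hc : 0 ≤ c)
    (hd : 0 ≤ d) : √a * √b + √c * √d ≤ √(a + c) * √(b + d) := by
  rw [← Real.sqrt_mul (add_nonneg ha hc)]
  refine Real.le_sqrt_of_sq_le ?_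
  nlinarith [sq_nonneg (√a * √d - √b * √c), Real.sq_sqrt ha, Real.sq_sqrt hb, Real.sq_sqrt hc,
    Real.sq_sqrt hd]

theorem IsPSDKernel.schwarz_of_two_sided_bound {Y : Type v} {G : Y → Type w}
    [∀ x, NormedAddCommGroup (G x)] [∀ x, InnerProductSpace 𝕜 (G x)] [∀ x, CompleteSpace (G x)]
    {K L : ∀ y x : Y, G x →L[𝕜] G y} (hP : IsPSDKernel (fun y x => K y x - -(L y x)))
    (hN : IsPSDKernel (fun y x => L y x - K y x)) {n m : ℕ} (x : Fin n → Y) (y : Fin m → Y)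
    (f : ∀ i, G (x i)) (g : ∀ j, G (y j)) :
    ‖∑ i, ∑ j, ⟪K (y j) (x i) (f i), g j⟫_𝕜‖ ≤
      √(RCLike.re (∑ i, ∑ i', ⟪L (x i') (x i) (f i), f i'⟫_𝕜)) *
      √(RCLike.re (∑ j, ∑ j', ⟪L (y j') (y j) (g j), g j'⟫_𝕜)) := by
  have key := (add_le_add (hP.norm_sum_le x y f g) (hN.norm_sum_le x y f g)).trans
    (sqrt_mul_add_sqrt_mul_le (hP.2 n x f) (hP.2 m y g) (hN.2 n x f) (hN.2 m y g))
  have key' := (norm_sub_le _ _).trans key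
  have e : ∀ a b : 𝕜, a + b - (b - a) = 2 * a := fun a b => by ring
  have e' : ∀ a b : ℝ, a + b + (b - a) = 2 * b := fun a b => by ring
  simp only [sub_neg_eq_add, add_apply, sub_apply, inner_add_left, inner_sub_left,
    Finset.sum_add_distrib, Finset.sum_sub_distrib, map_add, map_sub, e, e', norm_mul,
    RCLike.norm_two, Real.sqrt_mul zero_le_two] at key'
  rw [mul_mul_mul_comm, Real.mul_self_sqrt zero_le_two] at key'
  exact le_of_mul_le_mul_left key' two_pos

theorem ContinuousLinearMap.isPositive_of_mul_self_eq_add_self {E : Type*} [NormedAddCommGroup E]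
    [InnerProductSpace 𝕜 E] [CompleteSpace E] {T : E →L[𝕜] E} (hT : IsSelfAdjoint T)
    (h : T * T = T + T) : T.IsPositive := by
  refine isPositive_def'.2 ⟨hT, fun z => ?_⟩
  have hz : ⟪T z, T z⟫_𝕜 = ⟪T z, z⟫_𝕜 + ⟪T z, z⟫_𝕜 := by
    rw [← inner_add_left, ← add_apply, ← h, ← adjoint_inner_left, hT.adjoint_eq]
    rfl
  have := congrArg RCLike.re hz
  rw [inner_self_eq_norm_sq, map_add] at this
  rw [reApplyInnerSelf_apply]
  nlinarith [sq_nonneg ‖T z‖]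

theorem KSp.isPositive_one_add_J (𝒦 : KSp.{u, w'} 𝕜) : (1 + 𝒦.J).IsPositive := by
  have hJ : 𝒦.J * 𝒦.J = 1 := 𝒦.J_sq
  refine isPositive_of_mul_self_eq_add_self (.add (.one _) 𝒦.J_adj) ?_
  simp only [mul_add, add_mul, mul_one, one_mul, hJ]
  abel

theorem KSp.isPositive_one_sub_J (𝒦 : KSp.{u, w'} 𝕜) : (1 - 𝒦.J).IsPositive := by
  have hJ : 𝒦.J * 𝒦.J = 1 := 𝒦.J_sq
  refine isPositive_of_mul_self_eq_add_self (.sub (.one _) 𝒦.J_adj) ?_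
  simp only [mul_sub, sub_mul, mul_one, one_mul, hJ]
  abel

theorem IsPartKreinLin.exists_two_sided_bound {q : X → S} {K : ∀ y x : X, H x →L[𝕜] H y}
    {𝒦 : S → KSp.{u, w'} 𝕜} {V : ∀ x : X, H x →L[𝕜] (𝒦 (q x)).carrier}
    (hV : IsPartKreinLin q K 𝒦 V) :
    ∃ L : ∀ y x : X, H x →L[𝕜] H y, PartPSDP q L ∧
      PKLE q (fun y x => -(L y x)) K ∧ PKLE q K L := by
  let W : ∀ s, ∀ x : {x // q x = s}, H x.1 →L[𝕜] (𝒦 s).carrier := fun s x =>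
    ((castK 𝕜 𝒦 x.2).toContinuousLinearEquiv : (𝒦 (q x)).carrier →L[𝕜] (𝒦 s).carrier).comp (V x)
  have hW : ∀ s (x y : {x // q x = s}) h k, ⟪K y x h, k⟫_𝕜 = ⟪(𝒦 s).J (W s x h), W s y k⟫_𝕜 := by
    rintro s x ⟨y, rfl⟩ h k
    exact hV y x x.2 h k
  let L := glueKernels q (fun y x => (0 : H x →L[𝕜] H y)) fun s y x => adjoint (W s y) ∘L W s x
  have hL : ∀ s (x y : {x // q x = s}) h k, ⟪L y x h, k⟫_𝕜 = ⟪W s x h, W s y k⟫_𝕜 := by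
    intro s x y h k
    simp only [L, glueKernels_apply, comp_apply, adjoint_inner_left]
  refine ⟨L, partPSDP_iff.2 fun s => .of_isPositive (W s) isPositive_one (hL s),
    partPSDP_iff.2 fun s => .of_isPositive (W s) (𝒦 s).isPositive_one_add_J fun x y h k => ?_,
    partPSDP_iff.2 fun s => .of_isPositive (W s) (𝒦 s).isPositive_one_sub_J fun x y h k => ?_⟩
  · rw [sub_neg_eq_add, add_apply, add_apply, inner_add_left, inner_add_left, hW, hL, add_comm]
    rfl
  · rw [sub_apply, sub_apply, inner_sub_left, inner_sub_left, hW, hL]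
    rfl

theorem two_sided_bound_of_schwarz {q : X → S} {K L : ∀ y x : X, H x →L[𝕜] H y}
    (hK : PartHermitianP q K) (hL : PartPSDP q L)
    (h : ∀ (s : S) (n : ℕ) (x : Fin n → X), (∀ i, q (x i) = s) → ∀ f : ∀ i, H (x i),
      ‖∑ i, ∑ j, ⟪K (x j) (x i) (f i), f j⟫_𝕜‖ ≤
        RCLike.re (∑ i, ∑ j, ⟪L (x j) (x i) (f i), f j⟫_𝕜)) :
    PKLE q (fun y x => -(L y x)) K ∧ PKLE q K L := by
  refine ⟨⟨fun x y hxy => ?_, fun s n x hx f => ?_⟩, ⟨fun x y hxy => ?_, fun s n x hx f => ?_⟩⟩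
  · simp only [sub_neg_eq_add, map_add, hK x y hxy, hL.1 x y hxy]
  · have := (abs_le.1 ((RCLike.abs_re_le_norm _).trans (h s n x hx f))).1
    simp only [sub_neg_eq_add, add_apply, inner_add_left, Finset.sum_add_distrib, map_add]
    linarith
  · rw [map_sub, hK x y hxy, hL.1 x y hxy]
  · have := (abs_le.1 ((RCLike.abs_re_le_norm _).trans (h s n x hx f))).2
    simp only [sub_apply, inner_sub_left, Finset.sum_sub_distrib, map_sub]
    linarith

/-- On each block, a difference of partially positive semidefinite kernels is a difference of
disjoint ones. -/
theorem exists_disjoint_blocks {q : X → S} {K L : ∀ y x : X, H x →L[𝕜] H y}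
    (hL : PartPSDP q L) (hKL : PKLE q K L) :
    ∃ L₁ L₂ : ∀ s, ∀ y x : {x // q x = s}, H x.1 →L[𝕜] H y.1, ∀ s, IsPSDKernel (L₁ s) ∧
      IsPSDKernel (L₂ s) ∧ DisjointKernels (L₁ s) (L₂ s) ∧
      ∀ y x, L₁ s y x - L₂ s y x = K y x := by
  have := fun s => (partPSDP_iff.1 hL s).exists_disjoint (partPSDP_iff.1 hKL s)
  choose L₁ L₂ h₁ h₂ hd hsub using this
  exact ⟨L₁, L₂, fun s => ⟨h₁ s, h₂ s, hd s, fun y x => by rw [hsub, sub_sub_cancel]⟩⟩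

theorem exists_disjoint_sub {q : X → S} {K L : ∀ y x : X, H x →L[𝕜] H y}
    (hL : PartPSDP q L) (hKL : PKLE q K L) :
    ∃ K₁ K₂ : ∀ y x : X, H x →L[𝕜] H y, PartPSDP q K₁ ∧ PartPSDP q K₂ ∧
      PDisjoint q K₁ K₂ ∧ ∀ y x : X, K y x = K₁ y x - K₂ y x := by
  obtain ⟨L₁, L₂, h⟩ := exists_disjoint_blocks hL hKL
  refine ⟨glueKernels q K L₁, glueKernels q (fun _ _ => 0) L₂, partPSDP_iff.2 fun s => ?_,
    partPSDP_iff.2 fun s => ?_, fun P hP hP₁ hP₂ y x hxy => ?_, fun y x => ?_⟩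
  · simpa only [glueKernels_apply] using (h s).1
  · simpa only [glueKernels_apply] using (h s).2.1
  · refine (h (q y)).2.2.1 (fun y x => P y x) (partPSDP_iff.1 hP _) ?_ ?_ ⟨y, rfl⟩ ⟨x, hxy⟩
    · simpa only [glueKernels_apply] using partPSDP_iff.1 hP₁ (q y)
    · simpa only [glueKernels_apply] using partPSDP_iff.1 hP₂ (q y)
  · by_cases hxy : q x = q y
    · have := (h (q y)).2.2.2 ⟨y, rfl⟩ ⟨x, hxy⟩
      rw [← glueKernels_apply q K L₁, ← glueKernels_apply q (fun _ _ => 0) L₂] at this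
      exact this.symm
    · rw [glueKernels_of_ne _ _ _ hxy, glueKernels_of_ne _ _ _ hxy, sub_zero]

theorem exists_minimal_krein {q : X → S} {K L : ∀ y x : X, H x →L[𝕜] H y}
    (hL : PartPSDP q L) (hKL : PKLE q K L) :
    ∃ (𝒦 : S → KSp.{u, max v w} 𝕜) (V : ∀ x : X, H x →L[𝕜] (𝒦 (q x)).carrier),
      IsPartKreinLin q K 𝒦 V ∧ IsMinimalPartKLin q 𝒦 V := by
  obtain ⟨L₁, L₂, h⟩ := exists_disjoint_blocks hL hKL
  have := fun s => (h s).2.2.1.exists_krein (h s).1 (h s).2.1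
  choose 𝒦 W hW hdense using this
  have hcast : ∀ s (x : {x // q x = s}) (k : H x.1),
      castK 𝕜 𝒦 x.2 (W (q x) ⟨x, rfl⟩ k) = W s x k := by
    rintro s ⟨x, rfl⟩ k
    rfl
  refine ⟨𝒦, fun x => W (q x) ⟨x, rfl⟩, fun x y hxy k h' => ?_, fun s => ?_⟩
  · rw [hcast (q x) ⟨y, hxy⟩ k, ← hW, ← sub_apply, (h (q x)).2.2.2]
  · have := hdense s
    simpa only [hcast] using this

end Partition

/-- for a kernel `K` partially Hermitian with respect to a
partition `{X_s}` of `X` (given by the fibres of a surjection `q : X → S`),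
the following are equivalent: (1) `-L ≤_P K ≤_P L` for some partially positive
semidefinite `L`; (1′) `K ≤_P L` for some partially positive semidefinite `L`;
(2) a fibrewise Schwarz inequality with respect to some partially positive
semidefinite `L`; (3) `K = K₁ - K₂` with `K₁, K₂` partially positive
semidefinite; (3′) the same with `K₁, K₂` disjoint; (4) `K` has a minimal
Krein space partial linearisation with respect to the partition. -/
theorem partial_hermitian_kernel_krein_tfae
    (q : X → S) (hq : Function.Surjective q)
    (K : ∀ y x : X, H x →L[𝕜] H y) (hK : PartHermitianP q K) :
    ((∃ L : ∀ y x : X, H x →L[𝕜] H y, PartPSDP q L ∧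
        PKLE q (fun y x => -(L y x)) K ∧ PKLE q K L) ↔
      (∃ L : ∀ y x : X, H x →L[𝕜] H y, PartPSDP q L ∧ PKLE q K L)) ∧
    ((∃ L : ∀ y x : X, H x →L[𝕜] H y, PartPSDP q L ∧
        PKLE q (fun y x => -(L y x)) K ∧ PKLE q K L) ↔
      (∃ L : ∀ y x : X, H x →L[𝕜] H y, PartPSDP q L ∧
        ∀ (s : S) (n m : ℕ) (x : Fin n → X) (y : Fin m → X),
          (∀ i, q (x i) = s) → (∀ j, q (y j) = s) →
          ∀ (f : ∀ i, H (x i)) (g : ∀ j, H (y j)),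
            ‖∑ i, ∑ j, ⟪K (y j) (x i) (f i), g j⟫_𝕜‖ ≤
              Real.sqrt
                (RCLike.re (∑ i, ∑ i', ⟪L (x i') (x i) (f i), f i'⟫_𝕜)) *
              Real.sqrt
                (RCLike.re (∑ j, ∑ j', ⟪L (y j') (y j) (g j), g j'⟫_𝕜)))) ∧
    ((∃ L : ∀ y x : X, H x →L[𝕜] H y, PartPSDP q L ∧
        PKLE q (fun y x => -(L y x)) K ∧ PKLE q K L) ↔
      (∃ K₁ K₂ : ∀ y x : X, H x →L[𝕜] H y, PartPSDP q K₁ ∧ PartPSDP q K₂ ∧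
        ∀ y x : X, K y x = K₁ y x - K₂ y x)) ∧
    ((∃ L : ∀ y x : X, H x →L[𝕜] H y, PartPSDP q L ∧
        PKLE q (fun y x => -(L y x)) K ∧ PKLE q K L) ↔
      (∃ K₁ K₂ : ∀ y x : X, H x →L[𝕜] H y, PartPSDP q K₁ ∧ PartPSDP q K₂ ∧
        PDisjoint q K₁ K₂ ∧ ∀ y x : X, K y x = K₁ y x - K₂ y x)) ∧
    ((∃ L : ∀ y x : X, H x →L[𝕜] H y, PartPSDP q L ∧
        PKLE q (fun y x => -(L y x)) K ∧ PKLE q K L) ↔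
      (∃ (𝒦 : S → KSp.{u, max v w} 𝕜)
          (V : ∀ x : X, H x →L[𝕜] (𝒦 (q x)).carrier),
        IsPartKreinLin q K 𝒦 V ∧ IsMinimalPartKLin q 𝒦 V)) := by
  have hsub : (∃ L : ∀ y x : X, H x →L[𝕜] H y, PartPSDP q L ∧ PKLE q K L) →
      ∃ K₁ K₂ : ∀ y x : X, H x →L[𝕜] H y, PartPSDP q K₁ ∧ PartPSDP q K₂ ∧
        ∀ y x : X, K y x = K₁ y x - K₂ y x :=
    fun ⟨L, hL, hKL⟩ => ⟨L, _, hL, hKL, fun y x => (sub_sub_cancel _ _).symm⟩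
  refine ⟨⟨fun ⟨L, hL, _, hKL⟩ => ⟨L, hL, hKL⟩, fun h => ?_⟩,
    ⟨fun ⟨L, hL, hKL', hKL⟩ => ⟨L, hL, fun s n m x y hx hy f g => ?_⟩,
      fun ⟨L, hL, h⟩ => ⟨L, hL, two_sided_bound_of_schwarz hK hL fun s n x hx f => ?_⟩⟩,
    ⟨fun ⟨L, hL, _, hKL⟩ => hsub ⟨L, hL, hKL⟩,
      fun ⟨K₁, K₂, h₁, h₂, h⟩ => exists_two_sided_bound_of_sub h₁ h₂ h⟩,
    ⟨fun ⟨L, hL, _, hKL⟩ => exists_disjoint_sub hL hKL,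
      fun ⟨K₁, K₂, h₁, h₂, _, h⟩ => exists_two_sided_bound_of_sub h₁ h₂ h⟩,
    ⟨fun ⟨L, hL, _, hKL⟩ => exists_minimal_krein hL hKL,
      fun ⟨𝒦, V, hV, _⟩ => hV.exists_two_sided_bound⟩⟩
  · obtain ⟨K₁, K₂, h₁, h₂, h⟩ := hsub h
    exact exists_two_sided_bound_of_sub h₁ h₂ h
  · exact (partPSDP_iff.1 hKL' s).schwarz_of_two_sided_bound (partPSDP_iff.1 hKL s)
      (fun i => ⟨x i, hx i⟩) (fun j => ⟨y j, hy j⟩) f g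
  · have := h s n n x x hx hx f f
    rwa [Real.mul_self_sqrt (hL.2 s n x hx f)] at this
end
end
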